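/- Assume R(0) = 0, R(1) = 1, that no c_i lies in {0,1}, and that no d_i lies in {0,1}. Let a ∈ ℂ and n ≥ 1 be such that for all 0 ≤ k ≤ n: R^k(a) ∉ {0,1}, q(R^k(a)) ≠ 0 and R'(R^k(a)) ≠ 0 (in particular R^k(a) is not a critical point, so γ_{R^k(a)}(c_i) is defined). Write (R^k)'(a) = Π_{j<k} R'(R^j(a)). Then, as elements of L¹(ℂ) (i.e. for m-almost every z): (R*)^n(γ_a) = γ_{R^n(a)}/(R^n)'(a) + Σ_{i=1}^{2d−2} b_i · Σ_{k=0}^{n−1} (γ_{R^k(a)}(c_i)/(R^k)'(a)) · (R*)^{n−1−k}(γ_{d_i}). -/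

import Mathlib

open MeasureTheory Polynomial Filter Topology

noncomputable section

/-- The rational map `R = p/q` as a function on `ℂ`. -/
def Rfun (p q : Polynomial ℂ) : ℂ → ℂ := fun z => p.eval z / q.eval z

/-- `z ∈ ℂ` is a critical value of `R = p/q`. -/
def IsCritValue (p q : Polynomial ℂ) (z : ℂ) : Prop :=
  ∃ c : ℂ, q.eval c ≠ 0 ∧ deriv (Rfun p q) c = 0 ∧ Rfun p q c = z

/-- The Ruelle (transfer) operator: `(R*φ)(z) = ∑_{R(y) = z} φ(y)/(R'(y))²`,
the sum being over the fiber of `R = p/q` over `z`. -/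
def ruelleOp (p q : Polynomial ℂ) (φ : ℂ → ℂ) : ℂ → ℂ := fun z =>
  ∑' y : {y : ℂ // q.eval y ≠ 0 ∧ Rfun p q y = z},
    φ (y : ℂ) / (deriv (Rfun p q) (y : ℂ)) ^ 2

/-- `(Rⁿ)'(a) = ∏_{j<n} R'(Rʲ(a))`. -/
def derivIter (p q : Polynomial ℂ) (n : ℕ) (a : ℂ) : ℂ :=
  ∏ j ∈ Finset.range n, deriv (Rfun p q) ((Rfun p q)^[j] a)

/-- `γ_a(z) = a(a-1)/(z(z-1)(z-a))`. -/
def gam (a z : ℂ) : ℂ := a * (a - 1) / (z * (z - 1) * (z - a))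


lemma sum_toFinset_of_nodup {α M : Type*} [DecidableEq α] [AddCommMonoid M] {s : Multiset α}
    (hs : s.Nodup) (f : α → M) : ∑ x ∈ s.toFinset, f x = (s.map f).sum := by
  rw [Finset.sum, Multiset.toFinset_val, hs.dedup]

lemma nodup_roots_of_derivative_ne_zero {K : Type*} [Field K] (D : K[X])
    (hD : ∀ x, D.IsRoot x → D.derivative.eval x ≠ 0) : D.roots.Nodup := by
  classical
  by_cases hD0 : D = 0
  · simp [hD0]
  rw [Multiset.nodup_iff_count_le_one]
  intro x
  rw [count_roots]
  by_contra! h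
  rw [one_lt_rootMultiplicity_iff_isRoot hD0] at h
  exact hD x h.1 h.2

lemma natDegree_of_eq_X_sub_C_mul {K : Type*} [Field K] {f g : K[X]} {x : K}
    (h : f = (X - C x) * g) : g.natDegree = f.natDegree - 1 := by
  by_cases hg : g = 0
  · simp [h, hg]
  · rw [h, natDegree_mul (X_sub_C_ne_zero x) hg, natDegree_X_sub_C, Nat.add_sub_cancel_left]

lemma sum_roots_eval_div_eval_derivative_eq_zero {K : Type*} [Field K] [IsAlgClosed K]
    (P D : K[X]) (hdeg : P.natDegree + 2 ≤ D.natDegree)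
    (hD : ∀ x, D.IsRoot x → D.derivative.eval x ≠ 0) :
    (D.roots.map fun x => P.eval x / D.derivative.eval x).sum = 0 := by
  classical
  have hD0 : D ≠ 0 := by rintro rfl; simp at hdeg
  have hnodup : D.roots.Nodup := nodup_roots_of_derivative_ne_zero D hD
  have hsplits : D.Splits := IsAlgClosed.splits D
  have hcard : D.roots.toFinset.card = D.natDegree := by
    rw [Multiset.toFinset_card_of_nodup hnodup, hsplits.natDegree_eq_card_roots]
  have hfac : D = C D.leadingCoeff * Lagrange.nodal D.roots.toFinset id := by
    conv_lhs => rw [hsplits.eq_prod_roots]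
    rw [Lagrange.nodal, Finset.prod, Multiset.toFinset_val, hnodup.dedup]
    rfl
  have hPdeg : P.degree < D.roots.toFinset.card := by
    rw [hcard]
    exact lt_of_le_of_lt degree_le_natDegree (by exact_mod_cast (by omega))
  have hcoeff := Lagrange.coeff_eq_sum (s := D.roots.toFinset) (v := id)
    Function.injective_id.injOn hPdeg
  rw [hcard, coeff_eq_zero_of_natDegree_lt (by omega)] at hcoeff
  rw [← sum_toFinset_of_nodup hnodup, ← zero_div D.leadingCoeff, hcoeff, Finset.sum_div]
  refine Finset.sum_congr rfl fun x hx => ?_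
  have hder : D.derivative.eval x = D.leadingCoeff * ∏ y ∈ D.roots.toFinset.erase x, (x - y) := by
    conv_lhs => rw [hfac]
    rw [derivative_C_mul, eval_C_mul]
    refine congrArg _ ((Lagrange.eval_nodal_derivative_eval_node_eq (v := id) hx).trans ?_)
    rw [Lagrange.eval_nodal]
    rfl
  rw [hder, div_div, mul_comm]
  rfl

/-- The numerator of the derivative of `p / q`. -/
def wronskianNum (p q : ℂ[X]) : ℂ[X] := derivative p * q - p * derivative q

lemma deriv_Rfun (p q : ℂ[X]) {x : ℂ} (hx : q.eval x ≠ 0) :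
    deriv (Rfun p q) x = (wronskianNum p q).eval x / q.eval x ^ 2 := by
  refine ((p.hasDerivAt x).fun_div (q.hasDerivAt x) hx).deriv.trans ?_
  simp [wronskianNum]

lemma deriv_deriv_Rfun (p q : ℂ[X]) {x : ℂ} (hx : q.eval x ≠ 0)
    (hW : (wronskianNum p q).eval x = 0) :
    deriv (deriv (Rfun p q)) x = (wronskianNum p q).derivative.eval x / q.eval x ^ 2 := by
  have hev : deriv (Rfun p q) =ᶠ[𝓝 x]
      fun y => (wronskianNum p q).eval y / (q ^ 2).eval y := by
    filter_upwards [q.continuous.continuousAt.eventually_ne hx] with y hy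
    rw [deriv_Rfun p q hy, eval_pow]
  have hx2 : (q ^ 2).eval x ≠ 0 := by simpa using hx
  rw [hev.deriv_eq,
    (((wronskianNum p q).hasDerivAt x).fun_div ((q ^ 2).hasDerivAt x) hx2).deriv, hW, eval_pow]
  field_simp
  ring

lemma natDegree_C_mul_sub (p q : ℂ[X]) (hlt : q.natDegree < p.natDegree) (z : ℂ) :
    (C z * q - p).natDegree = p.natDegree :=
  natDegree_sub_eq_right_of_natDegree_lt ((natDegree_C_mul_le z q).trans_lt hlt)

lemma C_mul_sub_ne_zero (p q : ℂ[X]) (hlt : q.natDegree < p.natDegree) (z : ℂ) :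
    C z * q - p ≠ 0 := by
  intro h
  have := natDegree_C_mul_sub p q hlt z
  rw [h, natDegree_zero] at this
  omega

lemma isRoot_C_mul_sub_iff (p q : ℂ[X]) (hcop : IsCoprime p q) (z y : ℂ) :
    (C z * q - p).IsRoot y ↔ q.eval y ≠ 0 ∧ Rfun p q y = z := by
  simp only [IsRoot.def, eval_sub, eval_mul, eval_C, Rfun]
  constructor
  · intro h
    have hq : q.eval y ≠ 0 := by
      intro hq
      obtain ⟨u, v, huv⟩ := hcop
      have := congrArg (eval y) huv
      have hp : p.eval y = 0 := by rw [hq] at h; simpa using h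
      simp [hp, hq] at this
    refine ⟨hq, ?_⟩
    rw [div_eq_iff hq]
    linear_combination -h
  · rintro ⟨hq, h⟩
    rw [div_eq_iff hq] at h
    rw [h, sub_self]

lemma ruelleOp_eq_sum (p q : ℂ[X]) (hcop : IsCoprime p q) (hlt : q.natDegree < p.natDegree)
    (φ : ℂ → ℂ) (z : ℂ) :
    ruelleOp p q φ z =
      ∑ y ∈ (C z * q - p).roots.toFinset, φ y / deriv (Rfun p q) y ^ 2 := by
  have hset : {y : ℂ | q.eval y ≠ 0 ∧ Rfun p q y = z} = ↑(C z * q - p).roots.toFinset := by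
    ext y
    simp only [Set.mem_ofPred_eq, Finset.mem_coe, Multiset.mem_toFinset,
      mem_roots (C_mul_sub_ne_zero p q hlt z), isRoot_C_mul_sub_iff p q hcop]
  rw [← Finset.tsum_subtype', ← hset]
  rfl

/-- The Ruelle operator as a linear map. -/
def ruelleLin (p q : ℂ[X]) (hcop : IsCoprime p q) (hlt : q.natDegree < p.natDegree) :
    (ℂ → ℂ) →ₗ[ℂ] (ℂ → ℂ) where
  toFun := ruelleOp p q
  map_add' φ ψ := by
    ext z
    simp only [Pi.add_apply, ruelleOp_eq_sum p q hcop hlt, add_div, Finset.sum_add_distrib]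
  map_smul' r φ := by
    ext z
    simp only [Pi.smul_apply, smul_eq_mul, RingHom.id_apply, ruelleOp_eq_sum p q hcop hlt,
      Finset.mul_sum, mul_div_assoc]

lemma ruelleOp_congr_cofinite (p q : ℂ[X]) {φ ψ : ℂ → ℂ} (h : φ =ᶠ[cofinite] ψ) :
    ruelleOp p q φ =ᶠ[cofinite] ruelleOp p q ψ := by
  rw [EventuallyEq, eventually_cofinite] at h ⊢
  refine (h.image (Rfun p q)).subset fun z hz => ?_
  by_contra hnot
  refine hz (tsum_congr fun y => ?_)
  have : φ y = ψ y := by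
    by_contra hy
    exact hnot ⟨y, hy, y.2.2⟩
  rw [this]

lemma roots_wronskianNum (d : ℕ) (hd : 2 ≤ d) (p q : ℂ[X])
    (hdp : p.natDegree = d) (hdq : q.natDegree = d - 1) (hW : wronskianNum p q ≠ 0)
    (c : Fin (2 * d - 2) → ℂ) (hcinj : Function.Injective c)
    (hc : ∀ i, (wronskianNum p q).eval (c i) = 0) :
    (wronskianNum p q).roots = Finset.univ.val.map c ∧
      (wronskianNum p q).natDegree = 2 * d - 2 := by
  have hle : (wronskianNum p q).natDegree ≤ 2 * d - 2 := by
    have hp := natDegree_derivative_le p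
    have hq := natDegree_derivative_le q
    exact (natDegree_sub_le_of_le (natDegree_mul_le_of_le hp hdq.le)
      (natDegree_mul_le_of_le hdp.le hq)).trans (by omega)
  have hsub : Finset.univ.val.map c ≤ (wronskianNum p q).roots := by
    rw [Multiset.le_iff_subset (Finset.univ.nodup.map hcinj)]
    intro x hx
    obtain ⟨i, -, rfl⟩ := Multiset.mem_map.1 hx
    exact (mem_roots hW).2 (hc i)
  have hcard : (Finset.univ.val.map c).card = 2 * d - 2 := by simp
  have h1 := Multiset.card_le_card hsub
  have h2 := card_roots' (wronskianNum p q)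
  exact ⟨(Multiset.eq_of_le_of_card_le hsub (by omega)).symm, by omega⟩

/-- The action of the Ruelle operator on `γ_a`, outside a finite set. -/
lemma ruelleOp_gam (d : ℕ) (hd : 2 ≤ d) (p q : ℂ[X]) (hcop : IsCoprime p q)
    (hdp : p.natDegree = d) (hdq : q.natDegree = d - 1)
    (c : Fin (2 * d - 2) → ℂ) (hcinj : Function.Injective c)
    (hcq : ∀ i, q.eval (c i) ≠ 0)
    (hcderiv : ∀ i, deriv (Rfun p q) (c i) = 0)
    (hcsimple : ∀ i, deriv (deriv (Rfun p q)) (c i) ≠ 0)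
    (hq0 : q.eval 0 ≠ 0) (hR0 : Rfun p q 0 = 0)
    (hq1 : q.eval 1 ≠ 0) (hR1 : Rfun p q 1 = 1)
    (hc01 : ∀ i, c i ≠ 0 ∧ c i ≠ 1)
    (a : ℂ) (ha0 : a ≠ 0) (ha1 : a ≠ 1) (hqa : q.eval a ≠ 0) (hRa : deriv (Rfun p q) a ≠ 0) :
    ruelleOp p q (gam a) =ᶠ[cofinite] fun z =>
      gam (Rfun p q a) z / deriv (Rfun p q) a +
        ∑ i, (1 / deriv (deriv (Rfun p q)) (c i)) * (gam a (c i) * gam (Rfun p q (c i)) z) := by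
  have hlt : q.natDegree < p.natDegree := by omega
  set W := wronskianNum p q with hWdef
  have hWc : ∀ i, W.eval (c i) = 0 := fun i => by
    have := hcderiv i
    rw [deriv_Rfun p q (hcq i), div_eq_zero_iff] at this
    exact this.resolve_right (pow_ne_zero 2 (hcq i))
  have hWc' : ∀ i, W.derivative.eval (c i) ≠ 0 := fun i h => by
    apply hcsimple i
    rw [deriv_deriv_Rfun p q (hcq i) (hWc i), ← hWdef, h, zero_div]
  have hWa : W.eval a ≠ 0 := fun h => by
    apply hRa
    rw [deriv_Rfun p q hqa, ← hWdef, h, zero_div]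
  have hW0 : W ≠ 0 := fun h => hWa (by rw [h, eval_zero])
  obtain ⟨hWroots, hWdeg⟩ := roots_wronskianNum d hd p q hdp hdq hW0 c hcinj hWc
  obtain ⟨p₁, hp₁⟩ : X - C 0 ∣ p := by
    rw [dvd_iff_isRoot, IsRoot.def]
    exact (div_eq_zero_iff.1 hR0).resolve_right hq0
  obtain ⟨r₁, hr₁⟩ : X - C 1 ∣ p - q := by
    rw [dvd_iff_isRoot, IsRoot.def, eval_sub, sub_eq_zero]
    exact (div_eq_one_iff_eq hq1).1 hR1
  have hp₁deg : p₁.natDegree = d - 1 := by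
    rw [natDegree_of_eq_X_sub_C_mul hp₁, hdp]
  have hr₁deg : r₁.natDegree = d - 1 := by
    rw [natDegree_of_eq_X_sub_C_mul hr₁, natDegree_sub_eq_left_of_natDegree_lt hlt, hdp]
  have hp₁eval : ∀ x, p.eval x = x * p₁.eval x := fun x => by
    conv_lhs => rw [hp₁]
    simp
  have hr₁eval : ∀ x, p.eval x - q.eval x = (x - 1) * r₁.eval x := fun x => by
    rw [← eval_sub, hr₁]
    simp
  have hgood : ∀ᶠ z in cofinite, z ≠ 0 ∧ z ≠ 1 ∧ z ≠ Rfun p q a ∧ ∀ i, z ≠ Rfun p q (c i) := by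
    refine (eventually_cofinite_ne 0).and ((eventually_cofinite_ne 1).and
      ((eventually_cofinite_ne _).and ?_))
    rw [eventually_all]
    exact fun i => eventually_cofinite_ne _
  filter_upwards [hgood] with z ⟨hz0, hz1, hza, hzc⟩
  set V := C z * q - p with hVdef
  have hV0 : V ≠ 0 := C_mul_sub_ne_zero p q hlt z
  have hVdeg : V.natDegree = d := by rw [hVdef, natDegree_C_mul_sub p q hlt z, hdp]
  have hVeval : ∀ x, V.eval x = z * q.eval x - p.eval x := fun x => by simp [hVdef]
  have hVroot : ∀ y, V.eval y = 0 ↔ q.eval y ≠ 0 ∧ Rfun p q y = z :=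
    isRoot_C_mul_sub_iff p q hcop z
  have hVa : V.eval a ≠ 0 := fun h => hza ((hVroot a).1 h).2.symm
  have hVc : ∀ i, V.eval (c i) ≠ 0 := fun i h => hzc i ((hVroot _).1 h).2.symm
  have hac : ∀ i, c i - a ≠ 0 := fun i h => hWa (by rw [← sub_eq_zero.1 h, hWc])
  have hWroot : ∀ x, W.eval x = 0 → ∃ i, c i = x := fun x hx => by
    have : x ∈ W.roots := (mem_roots hW0).2 hx
    rw [hWroots, Multiset.mem_map] at this
    obtain ⟨i, -, hi⟩ := this
    exact ⟨i, hi⟩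
  have hWy : ∀ y, V.eval y = 0 → W.eval y ≠ 0 := fun y hy h => by
    obtain ⟨i, rfl⟩ := hWroot y h
    exact hVc i hy
  have hay : ∀ y, V.eval y = 0 → y - a ≠ 0 := fun y hy h =>
    hVa (by rw [← sub_eq_zero.1 h, hy])
  have hVder : ∀ y, V.eval y = 0 → V.derivative.eval y * q.eval y = - W.eval y := fun y hy => by
    rw [hVeval] at hy
    simp only [hVdef, hWdef, wronskianNum, derivative_sub, derivative_C_mul, eval_sub, eval_mul,
      eval_C]
    linear_combination q.derivative.eval y * hy
  have hVder0 : ∀ y, V.eval y = 0 → V.derivative.eval y ≠ 0 := fun y hy h => by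
    have := hVder y hy
    rw [h, zero_mul, zero_eq_neg] at this
    exact hWy y hy this
  set D := (X - C a) * (W * V) with hDdef
  have hWV0 : W * V ≠ 0 := mul_ne_zero hW0 hV0
  have hD0 : D ≠ 0 := mul_ne_zero (X_sub_C_ne_zero a) hWV0
  have hDdeg : D.natDegree = 3 * d - 1 := by
    rw [hDdef, natDegree_mul (X_sub_C_ne_zero a) hWV0, natDegree_mul hW0 hV0, natDegree_X_sub_C,
      hWdeg, hVdeg]
    omega
  have hDder : ∀ x, D.derivative.eval x = W.eval x * V.eval x +
      (x - a) * (W.derivative.eval x * V.eval x + W.eval x * V.derivative.eval x) := fun x => by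
    simp only [hDdef, derivative_mul, derivative_X_sub_C, eval_add, eval_mul, eval_sub, eval_X,
      eval_C, one_mul]
  have hDa : D.derivative.eval a = W.eval a * V.eval a := by rw [hDder]; ring
  have hDc : ∀ i, D.derivative.eval (c i) =
      (c i - a) * (W.derivative.eval (c i) * V.eval (c i)) := fun i => by
    rw [hDder, hWc]; ring
  have hDy : ∀ y, V.eval y = 0 →
      D.derivative.eval y = (y - a) * (W.eval y * V.derivative.eval y) := fun y hy => by
    rw [hDder, hy]; ring
  have hDsimple : ∀ x, D.IsRoot x → D.derivative.eval x ≠ 0 := by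
    intro x hx
    simp only [hDdef, IsRoot.def, eval_mul, eval_sub, eval_X, eval_C, mul_eq_zero] at hx
    rcases hx with hx | hx | hx
    · rw [sub_eq_zero.1 hx, hDa]
      exact mul_ne_zero hWa hVa
    · obtain ⟨i, rfl⟩ := hWroot x hx
      rw [hDc]
      exact mul_ne_zero (hac i) (mul_ne_zero (hWc' i) (hVc i))
    · rw [hDy x hx]
      exact mul_ne_zero (hay x hx) (mul_ne_zero (hWy x hx) (hVder0 x hx))
  have hVnodup : V.roots.Nodup := nodup_roots_of_derivative_ne_zero V hVder0
  have hres := sum_roots_eval_div_eval_derivative_eq_zero (q * (p₁ * r₁)) D (by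
    have h1 : (q * (p₁ * r₁)).natDegree ≤ _ := natDegree_mul_le
    have h2 : (p₁ * r₁).natDegree ≤ _ := natDegree_mul_le
    omega) hDsimple
  rw [hDdef, roots_mul hD0, roots_mul hWV0, roots_X_sub_C, hWroots, ← hDdef] at hres
  simp only [Multiset.map_add, Multiset.sum_add, Multiset.map_singleton, Multiset.sum_singleton,
    Multiset.map_map, Function.comp_def] at hres
  have hz1' := sub_ne_zero.2 hz1
  have hnum : ∀ x, x ≠ 0 → x ≠ 1 → (q * (p₁ * r₁)).eval x =
      q.eval x * p.eval x * (p.eval x - q.eval x) / (x * (x - 1)) := fun x hx0 hx1 => by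
    have hx1' := sub_ne_zero.2 hx1
    rw [hr₁eval, hp₁eval]
    simp only [eval_mul]
    field_simp
  have hgamR : ∀ x, q.eval x ≠ 0 → V.eval x ≠ 0 → gam (Rfun p q x) z =
      p.eval x * (p.eval x - q.eval x) / (q.eval x * V.eval x) / (z * (z - 1)) :=
    fun x hqx hVx => by
    have h1 : z - p.eval x / q.eval x = V.eval x / q.eval x := by
      rw [hVeval]; field_simp
    rw [gam, Rfun, h1]
    field_simp
  have hterm_a : gam (Rfun p q a) z / deriv (Rfun p q) a = a * (a - 1) / (z * (z - 1)) *
      ((q * (p₁ * r₁)).eval a / D.derivative.eval a) := by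
    have ha1' := sub_ne_zero.2 ha1
    rw [hgamR a hqa hVa, deriv_Rfun p q hqa, ← hWdef, hnum a ha0 ha1, hDa]
    field_simp
  have hterm_c : ∀ i, (1 / deriv (deriv (Rfun p q)) (c i)) *
      (gam a (c i) * gam (Rfun p q (c i)) z) = a * (a - 1) / (z * (z - 1)) *
      ((q * (p₁ * r₁)).eval (c i) / D.derivative.eval (c i)) := fun i => by
    obtain ⟨hc0, hc1⟩ := hc01 i
    have hc1' := sub_ne_zero.2 hc1
    have hca := hac i
    have hW' := hWc' i
    have hV := hVc i
    have hq := hcq i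
    rw [hgamR _ hq hV, deriv_deriv_Rfun p q hq (hWc i), ← hWdef, hnum _ hc0 hc1, hDc, gam]
    field_simp
  have hterm_y : ∀ y, V.eval y = 0 → gam a y / deriv (Rfun p q) y ^ 2 =
      -(a * (a - 1) / (z * (z - 1)) *
        ((q * (p₁ * r₁)).eval y / D.derivative.eval y)) := fun y hy => by
    obtain ⟨hqy, hRy⟩ := (hVroot y).1 hy
    have hpy : p.eval y = z * q.eval y := by
      rw [hVeval] at hy; linear_combination -hy
    have hy0 : y ≠ 0 := by rintro rfl; exact hz0 (hRy.symm.trans hR0)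
    have hy1 : y ≠ 1 := by rintro rfl; exact hz1 (hRy.symm.trans hR1)
    have hy1' := sub_ne_zero.2 hy1
    have h1 := hay y hy
    have h2 := hWy y hy
    have h3 : V.derivative.eval y = - W.eval y / q.eval y := by
      rw [eq_div_iff hqy, hVder y hy]
    have h4 : z * q.eval y - q.eval y = (z - 1) * q.eval y := by ring
    rw [deriv_Rfun p q hqy, ← hWdef, hnum y hy0 hy1, hDy y hy, h3, hpy, h4, gam]
    field_simp
  have hsumV : ruelleOp p q (gam a) z = -(a * (a - 1) / (z * (z - 1)) *
      (V.roots.map fun x => (q * (p₁ * r₁)).eval x / D.derivative.eval x).sum) := by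
    rw [ruelleOp_eq_sum p q hcop hlt, ← sum_toFinset_of_nodup hVnodup, Finset.mul_sum,
      ← Finset.sum_neg_distrib]
    exact Finset.sum_congr rfl fun y hy =>
      hterm_y y (isRoot_of_mem_roots (Multiset.mem_toFinset.1 hy))
  rw [hsumV, hterm_a, Finset.sum_congr rfl fun i _ => hterm_c i, ← Finset.mul_sum]
  rw [Finset.sum]
  linear_combination (-(a * (a - 1) / (z * (z - 1)))) * hres

theorem ruelle_iterate_of_gamma (d : ℕ) (hd : 2 ≤ d) (p q : Polynomial ℂ) (hcop : IsCoprime p q)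
    (hdp : p.natDegree = d) (hdq : q.natDegree = d - 1)
    (c : Fin (2 * d - 2) → ℂ) (hcinj : Function.Injective c)
    (hcq : ∀ i, q.eval (c i) ≠ 0)
    (hcderiv : ∀ i, deriv (Rfun p q) (c i) = 0)
    (hcsimple : ∀ i, deriv (deriv (Rfun p q)) (c i) ≠ 0)
    (hcall : ∀ z : ℂ, q.eval z ≠ 0 → deriv (Rfun p q) z = 0 → ∃ i, c i = z)
    (hq0 : q.eval 0 ≠ 0) (hR0 : Rfun p q 0 = 0)
    (hq1 : q.eval 1 ≠ 0) (hR1 : Rfun p q 1 = 1)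
    (hc01 : ∀ i, c i ≠ 0 ∧ c i ≠ 1)
    (hd01 : ∀ i, Rfun p q (c i) ≠ 0 ∧ Rfun p q (c i) ≠ 1)
    (a : ℂ) (n : ℕ) (hn : 1 ≤ n)
    (horb : ∀ k ≤ n, (Rfun p q)^[k] a ≠ 0 ∧ (Rfun p q)^[k] a ≠ 1 ∧
      q.eval ((Rfun p q)^[k] a) ≠ 0 ∧ deriv (Rfun p q) ((Rfun p q)^[k] a) ≠ 0) :
    ∀ᵐ z ∂(volume : Measure ℂ),
      (ruelleOp p q)^[n] (gam a) z =
        gam ((Rfun p q)^[n] a) z / derivIter p q n a +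
          ∑ i, (1 / deriv (deriv (Rfun p q)) (c i)) *
            ∑ k ∈ Finset.range n,
              (gam ((Rfun p q)^[k] a) (c i) / derivIter p q k a) *
                (ruelleOp p q)^[n - 1 - k] (gam (Rfun p q (c i))) z := by
  have hlt : q.natDegree < p.natDegree := by omega
  suffices h : ∀ n, (∀ k < n, (Rfun p q)^[k] a ≠ 0 ∧ (Rfun p q)^[k] a ≠ 1 ∧
      q.eval ((Rfun p q)^[k] a) ≠ 0 ∧ deriv (Rfun p q) ((Rfun p q)^[k] a) ≠ 0) →
      (ruelleOp p q)^[n] (gam a) =ᶠ[cofinite]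
        (derivIter p q n a)⁻¹ • gam ((Rfun p q)^[n] a) +
          ∑ i, (1 / deriv (deriv (Rfun p q)) (c i)) • ∑ k ∈ Finset.range n,
            (gam ((Rfun p q)^[k] a) (c i) / derivIter p q k a) •
              (ruelleOp p q)^[n - 1 - k] (gam (Rfun p q (c i))) by
    have hfin := h n fun k hk => horb k hk.le
    rw [EventuallyEq, eventually_cofinite] at hfin
    filter_upwards [compl_mem_ae_iff.2 (hfin.measure_zero volume)] with z hz
    rw [Set.mem_compl_iff, Set.mem_ofPred_eq, not_not] at hz
    rw [hz, div_eq_inv_mul]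
    simp only [Pi.add_apply, Pi.smul_apply, Finset.sum_apply, smul_eq_mul]
  clear hn horb n
  intro n
  induction n with
  | zero =>
    intro _
    refine EventuallyEq.of_eq ?_
    simp [derivIter]
  | succ n ih =>
    intro horb
    obtain ⟨h0, h1, hq, hR⟩ := horb n (Nat.lt_succ_self n)
    have hstep := ruelleOp_gam d hd p q hcop hdp hdq c hcinj hcq hcderiv hcsimple hq0 hR0 hq1 hR1
      hc01 _ h0 h1 hq hR
    have hIH := ruelleOp_congr_cofinite p q (ih fun k hk => horb k (hk.trans (Nat.lt_succ_self n)))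
    have hlin : ruelleOp p q = ruelleLin p q hcop hlt := rfl
    have hder : derivIter p q (n + 1) a =
        derivIter p q n a * deriv (Rfun p q) ((Rfun p q)^[n] a) := Finset.prod_range_succ _ _
    have hiter : ∀ i, ∀ k ∈ Finset.range n,
        ruelleOp p q ((ruelleOp p q)^[n - 1 - k] (gam (Rfun p q (c i)))) =
          (ruelleOp p q)^[n - k] (gam (Rfun p q (c i))) := fun i k hk => by
      rw [← Function.iterate_succ_apply' (ruelleOp p q)]
      have := Finset.mem_range.1 hk
      congr 1
      omega
    rw [Function.iterate_succ_apply']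
    refine hIH.trans ?_
    have hexpand : ruelleOp p q ((derivIter p q n a)⁻¹ • gam ((Rfun p q)^[n] a) +
          ∑ i, (1 / deriv (deriv (Rfun p q)) (c i)) • ∑ k ∈ Finset.range n,
            (gam ((Rfun p q)^[k] a) (c i) / derivIter p q k a) •
              (ruelleOp p q)^[n - 1 - k] (gam (Rfun p q (c i)))) =
        (derivIter p q n a)⁻¹ • ruelleOp p q (gam ((Rfun p q)^[n] a)) +
          ∑ i, (1 / deriv (deriv (Rfun p q)) (c i)) • ∑ k ∈ Finset.range n,
            (gam ((Rfun p q)^[k] a) (c i) / derivIter p q k a) •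
              (ruelleOp p q)^[n - k] (gam (Rfun p q (c i))) := by
      rw [← Finset.sum_congr rfl fun i _ => congrArg _ (Finset.sum_congr rfl fun k hk =>
        congrArg _ (hiter i k hk))]
      simp only [hlin, map_add, map_sum, map_smul]
    rw [hexpand]
    filter_upwards [hstep] with z hz
    simp only [Pi.add_apply, Pi.smul_apply, Finset.sum_apply, smul_eq_mul, hz,
      Finset.sum_range_succ, Nat.add_sub_cancel, Nat.sub_self, Function.iterate_zero, id_eq,
      mul_add, Finset.sum_add_distrib, hder, Function.iterate_succ_apply', mul_inv]
    have hlast : (derivIter p q n a)⁻¹ * ∑ i, (1 / deriv (deriv (Rfun p q)) (c i)) *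
          (gam ((Rfun p q)^[n] a) (c i) * gam (Rfun p q (c i)) z) =
        ∑ i, (1 / deriv (deriv (Rfun p q)) (c i)) *
          (gam ((Rfun p q)^[n] a) (c i) / derivIter p q n a * gam (Rfun p q (c i)) z) := by
      rw [Finset.mul_sum]
      exact Finset.sum_congr rfl fun i _ => by ring
    rw [hlast]
    ring

end
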